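/- Let n ≥ 3 and let d be any real number with 0 ≤ d ≤ n − 2. Then there exist N ≥ 1, a linear elliptic first-order operator Dψ = ∑ⱼ Aⱼ(x)(∂ψ/∂xⱼ) + B(x)ψ on ℝⁿ with smooth coefficients which has the strong unique continuation property, and a smooth solution φ : ℝⁿ → ℝ^N of Dφ = 0 with φ not identically zero, such that the Hausdorff dimension of the zero set satisfies dimH(N(φ)) = d. -/

import Mathlib

open MeasureTheory Metric Set Filter Topology ENNReal NNReal

noncomputable section

/-- `m`-dimensional Euclidean space. -/
abbrev Euc (m : ℕ) := EuclideanSpace ℝ (Fin m)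

/-- The semilinear first-order differential operator `φ ↦ ∑ⱼ Aⱼ(x) ∂φ/∂xⱼ + V(x, φ(x))`
applied to `φ` at the point `x`. -/
def semilinApply {n N : ℕ} (A : Fin n → Euc n → Matrix (Fin N) (Fin N) ℝ)
    (V : Euc n → (Fin N → ℝ) → (Fin N → ℝ)) (φ : Euc n → (Fin N → ℝ)) (x : Euc n) :
    Fin N → ℝ :=
  (∑ j, (A j x).mulVec (fderiv ℝ φ x (EuclideanSpace.single j 1))) + V x (φ x)

/-- Ellipticity of the principal symbol `ξ ↦ ∑ⱼ ξⱼ Aⱼ(x)` at every point of `U`. -/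
def IsElliptic {n N : ℕ} (A : Fin n → Euc n → Matrix (Fin N) (Fin N) ℝ)
    (U : Set (Euc n)) : Prop :=
  ∀ x ∈ U, ∀ ξ : Euc n, ξ ≠ 0 → IsUnit (∑ j, ξ j • A j x)

/-- A set `S ⊆ ℝⁿ` is countably `m`-`C^∞`-rectifiable if it is contained in a countable
union of ranges of smooth maps `ℝᵐ → ℝⁿ`. -/
def CountablyCinfRectifiable {n : ℕ} (m : ℕ) (S : Set (Euc n)) : Prop :=
  ∃ g : ℕ → (Euc m → Euc n), (∀ i, ContDiff ℝ (⊤ : ℕ∞) (g i)) ∧ S ⊆ ⋃ i, range (g i)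

/-- The linear first-order differential operator `ψ ↦ ∑ⱼ Aⱼ(x) ∂ψ/∂xⱼ + B(x)ψ`
applied to `ψ` at the point `x`. -/
def linApply {n N : ℕ} (A : Fin n → Euc n → Matrix (Fin N) (Fin N) ℝ)
    (B : Euc n → Matrix (Fin N) (Fin N) ℝ) (ψ : Euc n → (Fin N → ℝ)) (x : Euc n) :
    Fin N → ℝ :=
  (∑ j, (A j x).mulVec (fderiv ℝ ψ x (EuclideanSpace.single j 1))) + (B x).mulVec (ψ x)

/-- The strong unique continuation property for the linear operator, on all of `ℝⁿ`. -/
def HasSUCPlin {n N : ℕ} (A : Fin n → Euc n → Matrix (Fin N) (Fin N) ℝ)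
    (B : Euc n → Matrix (Fin N) (Fin N) ℝ) : Prop :=
  ∀ W : Set (Euc n), IsOpen W → IsConnected W → ∀ ψ : Euc n → (Fin N → ℝ),
    ContDiffOn ℝ (⊤ : ℕ∞) ψ W → (∀ x ∈ W, linApply A B ψ x = 0) →
    (∃ p ∈ W, ∀ k, iteratedFDeriv ℝ k ψ p = 0) → ∀ x ∈ W, ψ x = 0

theorem dimH_range_le_of_edist_le {X Y Z : Type*} [EMetricSpace Y] [EMetricSpace Z]
    (f : X → Y) (g : X → Z) (C ρ : ℝ≥0) (hρ : 0 < ρ)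
    (h : ∀ a b, edist (g a) (g b) ≤ C * edist (f a) (f b) ^ (ρ : ℝ)) :
    dimH (range g) ≤ dimH (range f) / ρ := by
  rcases isEmpty_or_nonempty X with hX | hX
  · simp [range_eq_empty]
  have hinv : ∀ a, f (Function.invFun f (f a)) = f a := fun a =>
    Function.invFun_eq ⟨a, rfl⟩
  have hH : HolderOnWith C ρ (g ∘ Function.invFun f) (range f) := by
    rintro _ ⟨a, rfl⟩ _ ⟨b, rfl⟩
    have := h (Function.invFun f (f a)) (Function.invFun f (f b))
    rwa [hinv, hinv] at this
  have hrange : range g = (g ∘ Function.invFun f) '' range f := by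
    rw [← range_comp]
    congr 1
    ext1 a
    have := h a (Function.invFun f (f a))
    rw [hinv, edist_self, ENNReal.zero_rpow_of_pos (by exact_mod_cast hρ), mul_zero] at this
    exact edist_le_zero.1 this
  rw [hrange]
  exact hH.dimH_image_le hρ

/-- The sum of the powers `r ^ i` over those `i` for which `a i` is true. -/
def binarySeries (r : ℝ) (a : ℕ → Bool) : ℝ := ∑' i, if a i then r ^ i else 0

theorem norm_ite_pow_le {r : ℝ} (h0 : 0 ≤ r) (b : Bool) (i : ℕ) :
    ‖(if b then r ^ i else 0 : ℝ)‖ ≤ r ^ i := by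
  split_ifs <;> simp [abs_of_nonneg h0, pow_nonneg h0]

theorem summable_binarySeries {r : ℝ} (h0 : 0 ≤ r) (h1 : r < 1) (a : ℕ → Bool) :
    Summable fun i => if a i then r ^ i else 0 :=
  Summable.of_norm_bounded (summable_geometric_of_lt_one h0 h1)
    fun i => norm_ite_pow_le h0 (a i) i

theorem continuous_binarySeries {r : ℝ} (h0 : 0 ≤ r) (h1 : r < 1) :
    Continuous (binarySeries r) := by
  refine continuous_tsum (fun i => ?_) (summable_geometric_of_lt_one h0 h1)
    fun i a => norm_ite_pow_le h0 (a i) i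
  exact (continuous_of_discreteTopology (f := fun b : Bool => if b then r ^ i else 0)).comp
    (continuous_apply i)

theorem binarySeries_eq_add {r : ℝ} (h0 : 0 ≤ r) (h1 : r < 1) (a : ℕ → Bool) (k : ℕ) :
    binarySeries r a = (∑ i ∈ Finset.range k, if a i then r ^ i else 0) +
      r ^ k * binarySeries r fun i => a (i + k) := by
  rw [binarySeries, ← (summable_binarySeries h0 h1 a).sum_add_tsum_nat_add k, binarySeries,
    ← _root_.tsum_mul_left]
  congr 2
  ext i
  rw [pow_add]
  split_ifs <;> ring

theorem binarySeries_nonneg {r : ℝ} (h0 : 0 ≤ r) (a : ℕ → Bool) : 0 ≤ binarySeries r a :=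
  tsum_nonneg fun i => by split_ifs <;> positivity

theorem binarySeries_le {r : ℝ} (h0 : 0 ≤ r) (h1 : r < 1) (a : ℕ → Bool) :
    binarySeries r a ≤ (1 - r)⁻¹ := by
  rw [← tsum_geometric_of_lt_one h0 h1]
  exact (summable_binarySeries h0 h1 a).tsum_le_tsum
    (fun i => (le_abs_self _).trans (norm_ite_pow_le h0 (a i) i)) (summable_geometric_of_lt_one h0 h1)

theorem abs_binarySeries_sub_le {r : ℝ} (h0 : 0 ≤ r) (h1 : r < 1) {a b : ℕ → Bool} {k : ℕ}
    (h : ∀ i < k, a i = b i) :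
    |binarySeries r a - binarySeries r b| ≤ r ^ k * (1 - r)⁻¹ := by
  rw [binarySeries_eq_add h0 h1 a k, binarySeries_eq_add h0 h1 b k,
    Finset.sum_congr rfl fun i hi => by rw [h i (Finset.mem_range.1 hi)],
    add_sub_add_left_eq_sub, ← mul_sub, abs_mul, abs_of_nonneg (pow_nonneg h0 k)]
  refine mul_le_mul_of_nonneg_left (abs_sub_le_iff.2 ⟨?_, ?_⟩) (pow_nonneg h0 k) <;>
  linarith [binarySeries_nonneg h0 fun i => a (i + k), binarySeries_nonneg h0 fun i => b (i + k),
    binarySeries_le h0 h1 fun i => a (i + k), binarySeries_le h0 h1 fun i => b (i + k)]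

theorem le_abs_binarySeries_sub {r : ℝ} (h0 : 0 ≤ r) (h1 : r < 1) {a b : ℕ → Bool} {k : ℕ}
    (h : ∀ i < k, a i = b i) (hk : a k ≠ b k) :
    r ^ k * ((1 - 2 * r) * (1 - r)⁻¹) ≤ |binarySeries r a - binarySeries r b| := by
  have h2 : (1 - 2 * r) * (1 - r)⁻¹ = 1 - r * (1 - r)⁻¹ := by
    have : 1 - r ≠ 0 := by linarith
    field_simp
    ring
  rw [binarySeries_eq_add h0 h1 a k, binarySeries_eq_add h0 h1 b k,
    Finset.sum_congr rfl fun i hi => by rw [h i (Finset.mem_range.1 hi)],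
    add_sub_add_left_eq_sub, ← mul_sub, abs_mul, abs_of_nonneg (pow_nonneg h0 k)]
  refine mul_le_mul_of_nonneg_left ?_ (pow_nonneg h0 k)
  rw [binarySeries_eq_add h0 h1 _ 1, binarySeries_eq_add h0 h1 (fun i => b (i + k)) 1, h2]
  simp only [Finset.sum_range_one, pow_zero, pow_one, zero_add]
  have ha := mul_le_mul_of_nonneg_left (binarySeries_le h0 h1 fun i => a (i + 1 + k)) h0
  have hb := mul_le_mul_of_nonneg_left (binarySeries_le h0 h1 fun i => b (i + 1 + k)) h0
  have ha' := mul_nonneg h0 (binarySeries_nonneg h0 fun i => a (i + 1 + k))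
  have hb' := mul_nonneg h0 (binarySeries_nonneg h0 fun i => b (i + 1 + k))
  rw [le_abs]
  cases hak : a k <;> cases hbk : b k <;> simp_all
  · right; linarith
  · left; linarith

theorem exists_dist_binarySeries_le {r s ρ : ℝ} (hr0 : 0 < r) (hr1 : r < 1) (hs0 : 0 < s)
    (hs1 : s < 1 / 2) (hρ : 0 < ρ) (h : s ^ ρ = r) :
    ∃ C : ℝ≥0, ∀ a b, edist (binarySeries r a) (binarySeries r b) ≤
      C * edist (binarySeries s a) (binarySeries s b) ^ ρ := by
  have hm : 0 < (1 - 2 * s) * (1 - s)⁻¹ :=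
    mul_pos (by linarith) (inv_pos.2 (by linarith))
  set m := (1 - 2 * s) * (1 - s)⁻¹
  refine ⟨((1 - r)⁻¹ * m⁻¹ ^ ρ).toNNReal, fun a b => ?_⟩
  have hC : 0 ≤ (1 - r)⁻¹ * m⁻¹ ^ ρ :=
    mul_nonneg (inv_nonneg.2 (by linarith)) (Real.rpow_nonneg (inv_nonneg.2 hm.le) _)
  rw [edist_dist, edist_dist, ENNReal.ofReal_rpow_of_nonneg dist_nonneg hρ.le,
    ← ENNReal.ofReal_coe_nnreal, Real.coe_toNNReal _ hC, ← ENNReal.ofReal_mul hC]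
  apply ENNReal.ofReal_le_ofReal
  rw [Real.dist_eq, Real.dist_eq]
  rcases eq_or_ne a b with rfl | hab
  · simp [Real.zero_rpow hρ.ne']
  have hlt : ∀ i < PiNat.firstDiff a b, a i = b i := fun i hi =>
    PiNat.apply_eq_of_lt_firstDiff hi
  have h1 := abs_binarySeries_sub_le hr0.le hr1 hlt
  have h2 := le_abs_binarySeries_sub hs0.le (by linarith) hlt (PiNat.apply_firstDiff_ne hab)
  set k := PiNat.firstDiff a b
  have h3 : r ^ k ≤ (m⁻¹ * |binarySeries s a - binarySeries s b|) ^ ρ := by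
    rw [← h, ← Real.rpow_natCast, ← Real.rpow_mul hs0.le, mul_comm, Real.rpow_mul hs0.le,
      Real.rpow_natCast]
    refine Real.rpow_le_rpow (by positivity) ?_ hρ.le
    rw [inv_mul_eq_div, le_div_iff₀ hm]
    exact h2
  rw [Real.mul_rpow (inv_nonneg.2 hm.le) (abs_nonneg _)] at h3
  calc _ ≤ r ^ k * (1 - r)⁻¹ := h1
    _ ≤ _ := mul_le_mul_of_nonneg_right h3 (inv_nonneg.2 (by linarith))
    _ = _ := by ring

/-- The parametrization of a self-similar Cantor dust in `ℝᵐ` with contraction ratio `r`. -/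
def dust (m : ℕ) (r : ℝ) (a : Fin m → ℕ → Bool) : Fin m → ℝ := fun i => binarySeries r (a i)

theorem isCompact_range_dust (m : ℕ) {r : ℝ} (h0 : 0 ≤ r) (h1 : r < 1) :
    IsCompact (range (dust m r)) :=
  isCompact_range (continuous_pi fun i =>
    (continuous_binarySeries h0 h1).comp (continuous_apply i))

theorem dimH_range_dust_le_div (m : ℕ) {r s ρ : ℝ} (hr0 : 0 < r) (hr1 : r < 1) (hs0 : 0 < s)
    (hs1 : s < 1 / 2) (hρ : 0 < ρ) (h : s ^ ρ = r) :
    dimH (range (dust m r)) ≤ dimH (range (dust m s)) / ENNReal.ofReal ρ := by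
  obtain ⟨C, hC⟩ := exists_dist_binarySeries_le hr0 hr1 hs0 hs1 hρ h
  refine dimH_range_le_of_edist_le (dust m s) (dust m r) C ρ.toNNReal (by simpa) fun a b => ?_
  rw [Real.coe_toNNReal _ hρ.le]
  refine edist_pi_le_iff.2 fun i => (hC _ _).trans ?_
  gcongr
  exact edist_le_pi_edist (dust m s a) (dust m s b) i

theorem dimH_range_dust_half (m : ℕ) : (m : ℝ≥0∞) ≤ dimH (range (dust m (1 / 2))) := by
  have hsub : Metric.ball (fun _ : Fin m => (1 / 2 : ℝ)) (1 / 2) ⊆ range (dust m (1 / 2)) := by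
    intro x hx
    have hx' : ∀ i, ∃ a : ℕ → Bool, binarySeries (1 / 2) a = x i := by
      intro i
      have hi : dist (x i) (1 / 2) < 1 / 2 := (dist_le_pi_dist x _ i).trans_lt hx
      rw [Real.dist_eq, abs_lt] at hi
      have hi2 : x i / 2 ∈ Icc (0 : ℝ) 1 := ⟨by linarith, by linarith⟩
      obtain ⟨a, -, ha⟩ := Real.ofDigits_SurjOn one_lt_two hi2
      refine ⟨fun k => decide (a k = 1), ?_⟩
      have : x i = 2 * Real.ofDigits a := by rw [ha]; ring
      rw [this, Real.ofDigits, ← _root_.tsum_mul_left, binarySeries]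
      congr 1
      ext k
      rcases Fin.exists_fin_two.1 ⟨a k, rfl⟩ with h | h
      · simp [h, Real.ofDigitsTerm]
      · simp [h, Real.ofDigitsTerm]
        rw [pow_succ]; field_simp
    choose a ha using hx'
    exact ⟨a, funext ha⟩
  calc (m : ℝ≥0∞) = dimH (Metric.ball (fun _ : Fin m => (1 / 2 : ℝ)) (1 / 2)) :=
        (Real.dimH_ball_pi_fin _ (by norm_num)).symm
    _ ≤ _ := dimH_mono hsub

theorem dimH_range_dust (m : ℕ) {α : ℝ} (h0 : 0 < α) (h1 : α < 1) :
    dimH (range (dust m ((1 / 2) ^ α⁻¹))) = ENNReal.ofReal (m * α) := by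
  have hα : 1 < α⁻¹ := (one_lt_inv₀ h0).2 h1
  set r : ℝ := (1 / 2) ^ α⁻¹ with hr
  have hr0 : 0 < r := by positivity
  have hr2 : r < 1 / 2 := by
    have := Real.rpow_lt_rpow_of_exponent_gt (x := 1 / 2) (by norm_num) (by norm_num) hα
    rwa [Real.rpow_one] at this
  apply le_antisymm
  · have key : ∀ σ : ℝ, 1 < σ → σ < α⁻¹ →
        dimH (range (dust m r)) ≤ ENNReal.ofReal (m * (α * σ)) := by
      intro σ h1σ hσ
      have hs2 : (1 / 2 : ℝ) ^ σ < 1 / 2 := by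
        have := Real.rpow_lt_rpow_of_exponent_gt (x := 1 / 2) (by norm_num) (by norm_num) h1σ
        simpa using this
      have hσ0 : 0 < σ := by linarith
      have hpos : 0 < α⁻¹ / σ := by positivity
      have h := dimH_range_dust_le_div m (r := r) (s := (1 / 2) ^ σ) (ρ := α⁻¹ / σ) hr0
        (by linarith) (by positivity) hs2 hpos
        (by rw [← Real.rpow_mul (by norm_num), mul_div_cancel₀ _ hσ0.ne'])
      refine h.trans ?_
      have hm : dimH (range (dust m ((1 / 2) ^ σ))) ≤ ENNReal.ofReal m := by
        rw [ENNReal.ofReal_natCast, ← Real.dimH_univ_pi_fin m]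
        exact dimH_mono (subset_univ _)
      refine (ENNReal.div_le_div_right hm _).trans ?_
      rw [← ENNReal.ofReal_div_of_pos hpos]
      apply ENNReal.ofReal_le_ofReal
      apply le_of_eq
      field_simp
    have hlim : Tendsto (fun σ : ℝ => ENNReal.ofReal (m * (α * σ))) (𝓝[>] 1)
        (𝓝 (ENNReal.ofReal (m * (α * 1)))) := by
      refine (ENNReal.continuous_ofReal.comp (by fun_prop)).continuousWithinAt.tendsto
    rw [mul_one] at hlim
    refine ge_of_tendsto hlim ?_
    filter_upwards [Ioo_mem_nhdsGT hα] with σ hσ using key σ hσ.1 hσ.2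
  · have h := dimH_range_dust_le_div m (r := 1 / 2) (s := r) (ρ := α) (by norm_num) (by norm_num)
      hr0 hr2 h0 (by rw [hr, ← Real.rpow_mul (by norm_num), inv_mul_cancel₀ h0.ne', Real.rpow_one])
    have h' := (dimH_range_dust_half m).trans h
    rw [ENNReal.le_div_iff_mul_le (by simp [h0]) (by simp)] at h'
    rwa [ENNReal.ofReal_mul (by positivity), ENNReal.ofReal_natCast]

theorem exists_isClosed_dimH_eq (m : ℕ) (hm : 1 ≤ m) {d : ℝ} (h0 : 0 ≤ d) (h1 : d ≤ m) :
    ∃ K : Set (Fin m → ℝ), IsClosed K ∧ dimH K = ENNReal.ofReal d := by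
  have hm0 : (0 : ℝ) < m := by exact_mod_cast hm
  rcases h0.eq_or_lt with rfl | h0
  · exact ⟨{0}, isClosed_singleton, by simp⟩
  rcases h1.eq_or_lt with rfl | h1
  · exact ⟨univ, isClosed_univ, by rw [Real.dimH_univ_pi_fin, ENNReal.ofReal_natCast]⟩
  have hα : 0 < d / m := by positivity
  have hα1 : d / m < 1 := (div_lt_one hm0).2 h1
  refine ⟨_, (isCompact_range_dust m (r := (1 / 2) ^ (d / m)⁻¹) (by positivity)
    (Real.rpow_lt_one (by norm_num) (by norm_num) (by positivity))).isClosed, ?_⟩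
  rw [dimH_range_dust m hα hα1, mul_div_cancel₀ _ hm0.ne']

theorem isBigO_pow_of_iteratedFDeriv_eq_zero {E : Type} [NormedAddCommGroup E] [NormedSpace ℝ E]
    (p : E) (k : ℕ) {F : Type} [NormedAddCommGroup F] [NormedSpace ℝ F] {f : E → F}
    (hf : ContDiffAt ℝ (⊤ : ℕ∞) f p) (h : ∀ k, iteratedFDeriv ℝ k f p = 0) :
    f =O[𝓝 p] fun x => ‖x - p‖ ^ k := by
  induction k generalizing F with
  | zero =>
    simpa using hf.continuousAt.norm.isBoundedUnder_le.isBigO_one ℝ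
  | succ k ih =>
    have hf' : ContDiffAt ℝ (⊤ : ℕ∞) (fderiv ℝ f) p := hf.fderiv_right (by simp)
    obtain ⟨C, hC⟩ := (ih hf' fun j => by
      rw [← norm_eq_zero, norm_iteratedFDeriv_fderiv, h, norm_zero]).bound
    have hd : ∀ᶠ x in 𝓝 p, DifferentiableAt ℝ f x :=
      ((hf.of_le (m := 1) (by exact_mod_cast le_top)).eventually (by simp)).mono
        fun x hx => hx.differentiableAt (by simp)
    obtain ⟨ε, hε, hball⟩ := Metric.eventually_nhds_iff_ball.1 (hC.and hd)
    have h0 : f p = 0 := by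
      rw [← norm_eq_zero, ← norm_iteratedFDeriv_zero (𝕜 := ℝ), h, norm_zero]
    refine Asymptotics.IsBigO.of_bound |C| (Metric.eventually_nhds_iff_ball.2 ⟨ε, hε, fun x hx => ?_⟩)
    have hsub : closedBall p ‖x - p‖ ⊆ ball p ε :=
      closedBall_subset_ball (by rwa [← dist_eq_norm])
    have := (convex_closedBall p ‖x - p‖).norm_image_sub_le_of_norm_fderiv_le (𝕜 := ℝ)
      (f := f) (C := |C| * ‖x - p‖ ^ k) (fun y hy => (hball y (hsub hy)).2) (fun y hy => ?_)
      (mem_closedBall_self (norm_nonneg _)) (y := x) (by simp [dist_eq_norm])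
    · rw [h0, sub_zero] at this
      refine this.trans_eq ?_
      simp [pow_succ, mul_assoc]
    · refine (hball y (hsub hy)).1.trans ?_
      rw [norm_pow, norm_norm]
      have hy' : ‖y - p‖ ≤ ‖x - p‖ := by simpa [dist_eq_norm] using hy
      exact mul_le_mul (le_abs_self C) (pow_le_pow_left₀ (norm_nonneg _) hy' _)
        (by positivity) (abs_nonneg _)

theorem tendsto_choose_smul_fwdDiff_iter {E F : Type*} [NormedAddCommGroup E] [NormedSpace ℝ E]
    [NormedAddCommGroup F] [NormedSpace ℝ F] {u : E → F} {p w : E}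
    (hflat : ∀ k : ℕ, u =O[𝓝 p] fun x => ‖x - p‖ ^ k) (i : ℕ) :
    Tendsto (fun j : ℕ => j.choose i • (fwdDiff ((j : ℝ)⁻¹ • w))^[i] u p) atTop (𝓝 0) := by
  have key : ∀ l : ℕ, Tendsto (fun j : ℕ => (j : ℝ) ^ i • u (p + l • (j : ℝ)⁻¹ • w)) atTop
      (𝓝 0) := by
    intro l
    have hinv : Tendsto (fun j : ℕ => (j : ℝ)⁻¹) atTop (𝓝 0) := tendsto_inv_atTop_nhds_zero_nat
    have ht : Tendsto (fun j : ℕ => p + l • (j : ℝ)⁻¹ • w) atTop (𝓝 p) := by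
      simpa using tendsto_const_nhds.add ((hinv.smul_const w).const_smul l)
    have hO := (Asymptotics.isBigO_refl (fun j : ℕ => (j : ℝ) ^ i) atTop).smul
      ((hflat (i + 1)).comp_tendsto ht)
    refine hO.trans_tendsto ?_
    have : Tendsto (fun j : ℕ => (j : ℝ)⁻¹ * ‖l • w‖ ^ (i + 1)) atTop (𝓝 0) := by
      simpa using hinv.mul_const (‖l • w‖ ^ (i + 1))
    refine this.congr' ?_
    filter_upwards [eventually_gt_atTop 0] with j hj
    have hj' : (0 : ℝ) < j := by exact_mod_cast hj
    simp only [Function.comp_apply, add_sub_cancel_left, smul_eq_mul]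
    rw [smul_comm l, norm_smul (j : ℝ)⁻¹, norm_inv, Real.norm_of_nonneg hj'.le, mul_pow, inv_pow, pow_succ]
    field_simp
    ring
  have key2 : Tendsto (fun j : ℕ => (j : ℝ) ^ i • (fwdDiff ((j : ℝ)⁻¹ • w))^[i] u p) atTop
      (𝓝 0) := by
    simp only [fwdDiff_iter_eq_sum_shift, Finset.smul_sum]
    rw [← Finset.sum_const_zero (s := Finset.range (i + 1))]
    refine tendsto_finsetSum _ fun l _ => ?_
    have := (key l).const_smul ((-1 : ℤ) ^ (i - l) * i.choose l)
    rw [smul_zero] at this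
    exact this.congr fun j => smul_comm _ _ _
  rw [tendsto_zero_iff_norm_tendsto_zero] at key2 ⊢
  refine squeeze_zero (fun _ => norm_nonneg _) (fun j => ?_) key2
  rw [← Nat.cast_smul_eq_nsmul ℝ, norm_smul, norm_smul]
  gcongr
  rw [Real.norm_natCast, norm_pow, Real.norm_natCast]
  exact_mod_cast Nat.choose_le_pow j i

theorem choose_mul_pow_le {i j : ℕ} (hij : i ≤ j) {a : ℝ} (ha : 0 ≤ a) (ha' : a ≤ 1 / 6) :
    (j.choose i : ℝ) * (a * i / j) ^ i ≤ (1 / 2) ^ i := by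
  rcases j.eq_zero_or_pos with rfl | hj
  · obtain rfl : i = 0 := by omega
    simp
  have hj' : (0 : ℝ) < j := by exact_mod_cast hj
  have h1 : (j.choose i : ℝ) ≤ j ^ i / i.factorial := Nat.choose_le_pow_div i j
  have h2 : (i : ℝ) ^ i / i.factorial ≤ 3 ^ i := by
    refine (Real.pow_div_factorial_le_exp i (by positivity) i).trans ?_
    rw [← Real.exp_one_pow]
    gcongr
    exact Real.exp_one_lt_three.le
  calc (j.choose i : ℝ) * (a * i / j) ^ i ≤ j ^ i / i.factorial * (a * i / j) ^ i := by gcongr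
    _ = a ^ i * ((i : ℝ) ^ i / i.factorial) := by
      rw [div_pow, mul_pow]; field_simp
    _ ≤ (1 / 6) ^ i * 3 ^ i := by gcongr
    _ = (1 / 2) ^ i := by rw [← mul_pow]; norm_num

section MeanValue

variable {E F : Type*} [NormedAddCommGroup E] [NormedSpace ℝ E]
  [MeasurableSpace E] [NormedAddCommGroup F] [NormedSpace ℝ F]

/-- `u` equals its averages against the rescaled kernel `η` on every closed ball contained in
`S`. -/
def HasMeanValueProperty (μ : Measure E) (η : E → ℝ) (u : E → F) (S : Set E) : Prop :=
  ∀ x R, 0 < R → closedBall x R ⊆ S → ∫ y, η y • u (x + R • y) ∂μ = u x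

variable [FiniteDimensional ℝ E] [BorelSpace E] {μ : Measure E} [μ.IsAddHaarMeasure]
  {η : E → ℝ} {K : ℝ≥0} {u : E → F}

theorem integrable_smul_of_support_subset (hη : Continuous η)
    (hsupp : Function.support η ⊆ closedBall 0 1) {v : E → F} (hv : Continuous v) :
    Integrable (fun y => η y • v y) μ :=
  (hη.smul hv).integrable_of_hasCompactSupport
    ((HasCompactSupport.of_support_subset_isCompact (isCompact_closedBall 0 1) hsupp).smul_right)

theorem norm_sub_le_of_hasMeanValueProperty (hη : LipschitzWith K η)
    (hsupp : Function.support η ⊆ closedBall 0 1) (hu : Continuous u) {p : E} {ρ M R : ℝ}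
    (hR : 0 < R) (hmean : HasMeanValueProperty μ η u (closedBall p ρ))
    (hM : ∀ x ∈ closedBall p ρ, ‖u x‖ ≤ M) {h : E} (hh : ‖h‖ ≤ R) {x : E}
    (hx : x ∈ closedBall p (ρ - 3 * R)) :
    ‖u (x + h) - u x‖ ≤ K * μ.real (closedBall 0 2) * (‖h‖ / R) * M := by
  have hxd : dist x p ≤ ρ - 3 * R := hx
  have hx1 : closedBall x R ⊆ closedBall p ρ := closedBall_subset_closedBall' (by linarith)
  have hx2 : closedBall (x + h) R ⊆ closedBall p ρ := closedBall_subset_closedBall' (by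
    have := dist_triangle (x + h) x p
    rw [dist_self_add_left] at this
    linarith)
  have hcont : ∀ z, Continuous fun y : E => u (z + R • y) := fun z => by fun_prop
  have hM0 : 0 ≤ M := (norm_nonneg _).trans (hM x (hx1 (mem_closedBall_self hR.le)))
  set w : E := R⁻¹ • h
  have hw : ‖w‖ = ‖h‖ / R := by
    rw [norm_smul, norm_inv, Real.norm_of_nonneg hR.le, inv_mul_eq_div]
  have hw1 : ‖w‖ ≤ 1 := by rw [hw]; exact (div_le_one hR).2 hh
  have hshift : u (x + h) = ∫ y, η (y - w) • u (x + R • y) ∂μ := by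
    rw [← hmean _ R hR hx2, ← integral_sub_right_eq_self _ w]
    congr 1
    ext y
    congr 2
    rw [smul_sub, smul_inv_smul₀ hR.ne']
    abel
  have h_int : Integrable (fun y => η (y - w) • u (x + R • y)) μ := by
    have := (integrable_smul_of_support_subset (μ := μ) hη.continuous hsupp
      (hcont (x + h))).comp_sub_right w
    refine this.congr (ae_of_all _ fun y => ?_)
    simp only
    congr 2
    rw [smul_sub, smul_inv_smul₀ hR.ne']
    abel
  rw [hshift, ← hmean _ R hR hx1, ← integral_sub h_int
    (integrable_smul_of_support_subset hη.continuous hsupp (hcont x))]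
  have hzero : ∀ y ∉ closedBall (0 : E) 2,
      η (y - w) • u (x + R • y) - η y • u (x + R • y) = 0 := by
    intro y hy
    rw [mem_closedBall_zero_iff, not_le] at hy
    have h1 : η (y - w) = 0 := by
      by_contra hne
      have := mem_closedBall_zero_iff.1 (hsupp hne)
      linarith [norm_sub_norm_le y w]
    have h2 : η y = 0 := by
      by_contra hne
      have := mem_closedBall_zero_iff.1 (hsupp hne)
      linarith
    rw [h1, h2, sub_self]
  rw [← setIntegral_eq_integral_of_forall_compl_eq_zero hzero]
  refine (norm_setIntegral_le_of_norm_le_const (C := K * (‖h‖ / R) * M)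
    measure_closedBall_lt_top fun y hy => ?_).trans_eq (by ring)
  rw [← sub_smul, norm_smul, ← hw]
  refine mul_le_mul ?_ (hM _ ?_) (norm_nonneg _) (by positivity)
  · have := hη.dist_le_mul (y - w) y
    rwa [dist_self_sub_left, dist_eq_norm] at this
  · rw [mem_closedBall_zero_iff] at hy
    have := dist_triangle (x + R • y) x p
    rw [dist_self_add_left, norm_smul, Real.norm_of_nonneg hR.le] at this
    rw [mem_closedBall]
    nlinarith

theorem HasMeanValueProperty.fwdDiff (hη : Continuous η)
    (hsupp : Function.support η ⊆ closedBall 0 1) (hu : Continuous u) {p : E} {ρ R : ℝ}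
    (hmean : HasMeanValueProperty μ η u (closedBall p ρ)) {h : E} (hh : ‖h‖ ≤ R) :
    HasMeanValueProperty μ η (_root_.fwdDiff h u) (closedBall p (ρ - R)) := by
  intro x r hr hx
  have hx2 : closedBall (x + h) r ⊆ closedBall p ρ := by
    intro y hy
    have hy' : y - h ∈ closedBall x r := by
      rw [mem_closedBall, dist_eq_norm] at hy ⊢
      rwa [sub_right_comm, sub_sub]
    have := hx hy'
    rw [mem_closedBall] at this ⊢
    have h3 := dist_triangle y (y - h) p
    rw [dist_self_sub_right] at h3
    linarith
  have hx1 : closedBall x r ⊆ closedBall p ρ :=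
    hx.trans (closedBall_subset_closedBall (by linarith [norm_nonneg h]))
  rw [_root_.fwdDiff, ← hmean _ r hr hx2, ← hmean _ r hr hx1, ← integral_sub
    (integrable_smul_of_support_subset hη hsupp (by fun_prop))
    (integrable_smul_of_support_subset hη hsupp (by fun_prop))]
  simp only [_root_.fwdDiff, smul_sub, add_right_comm]

theorem norm_fwdDiff_iter_le (hη : LipschitzWith K η)
    (hsupp : Function.support η ⊆ closedBall 0 1) (hu : Continuous u) {p : E} {ρ M R : ℝ}
    (hR : 0 < R) (hmean : HasMeanValueProperty μ η u (closedBall p ρ))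
    (hM : ∀ x ∈ closedBall p ρ, ‖u x‖ ≤ M) {h : E} (hh : ‖h‖ ≤ R) (k : ℕ) :
    Continuous ((fwdDiff h)^[k] u) ∧
    HasMeanValueProperty μ η ((fwdDiff h)^[k] u) (closedBall p (ρ - 3 * k * R)) ∧
    ∀ x ∈ closedBall p (ρ - 3 * k * R), ‖(fwdDiff h)^[k] u x‖ ≤
      (K * μ.real (closedBall 0 2) * (‖h‖ / R)) ^ k * M := by
  induction k with
  | zero => simpa using ⟨hu, hmean, hM⟩
  | succ k ih =>
    obtain ⟨h1, h2, h3⟩ := ih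
    rw [Function.iterate_succ_apply']
    have hr : ρ - 3 * (k + 1 : ℕ) * R = ρ - 3 * k * R - 3 * R := by push_cast; ring
    rw [hr]
    refine ⟨(h1.comp (by fun_prop)).sub h1, ?_, fun x hx => ?_⟩
    · intro x r hr hx
      exact h2.fwdDiff hη.continuous hsupp h1 hh x r hr
        (hx.trans (closedBall_subset_closedBall (by linarith)))
    · have := norm_sub_le_of_hasMeanValueProperty hη hsupp h1 hR h2 h3 hh hx
      rw [_root_.fwdDiff, pow_succ']
      linarith

/-- A function with the mean value property that vanishes to infinite order at the centre of a
ball vanishes on a smaller concentric ball, of proportional radius. -/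
theorem eq_zero_of_hasMeanValueProperty [CompleteSpace F] (hη : LipschitzWith K η)
    (hsupp : Function.support η ⊆ closedBall 0 1) (hu : Continuous u) {p : E} {ρ : ℝ}
    (hρ : 0 < ρ) (hmean : HasMeanValueProperty μ η u (closedBall p ρ))
    (hflat : ∀ k : ℕ, u =O[𝓝 p] fun x => ‖x - p‖ ^ k) {x : E}
    (hx : (K * μ.real (closedBall 0 2) + 1) * ‖x - p‖ ≤ ρ / 18) : u x = 0 := by
  set A : ℝ := K * μ.real (closedBall 0 2) with hA
  have hA0 : 0 ≤ A := by positivity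
  set w := x - p with hw
  obtain ⟨M, hM⟩ := (isCompact_closedBall p ρ).exists_bound_of_continuousOn hu.continuousOn
  have hM0 : 0 ≤ M := (norm_nonneg _).trans (hM p (mem_closedBall_self hρ.le))
  have hAw : A * ‖w‖ ≤ ρ / 18 := by nlinarith [norm_nonneg w]
  have hw1 : ‖w‖ ≤ ρ / 18 := by nlinarith [norm_nonneg w]
  let f : ℕ → ℕ → F := fun j i => j.choose i • (fwdDiff ((j : ℝ)⁻¹ • w))^[i] u p
  have hbound : ∀ j i, ‖f j i‖ ≤ (1 / 2) ^ i * M := by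
    intro j i
    rcases lt_or_ge j i with hji | hij
    · simp only [f, Nat.choose_eq_zero_of_lt hji, zero_smul, norm_zero]
      positivity
    rcases i.eq_zero_or_pos with rfl | hi
    · simpa [f] using hM p (mem_closedBall_self hρ.le)
    have hi' : (0 : ℝ) < i := by exact_mod_cast hi
    have hj' : (0 : ℝ) < j := by exact_mod_cast hi.trans_le hij
    have hij' : (i : ℝ) ≤ j := by exact_mod_cast hij
    have hnorm : ‖(j : ℝ)⁻¹ • w‖ = ‖w‖ / j := by
      rw [norm_smul, norm_inv, Real.norm_of_nonneg hj'.le, inv_mul_eq_div]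
    have hR : 0 < ρ / (3 * i) := by positivity
    have := (norm_fwdDiff_iter_le hη hsupp hu hR hmean hM (h := (j : ℝ)⁻¹ • w) ?_ i).2.2 p
      (mem_closedBall_self (le_of_eq ?_))
    · simp only [f]
      rw [← Nat.cast_smul_eq_nsmul ℝ, norm_smul, Real.norm_natCast]
      refine (mul_le_mul_of_nonneg_left this (by positivity)).trans ?_
      rw [← mul_assoc]
      refine mul_le_mul_of_nonneg_right ?_ hM0
      have hc := choose_mul_pow_le hij (a := 3 * (A * ‖w‖) / ρ) (by positivity) (by
        rw [div_le_iff₀ hρ]; linarith)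
      refine le_of_eq_of_le ?_ hc
      rw [hnorm, ← hA]
      congr 2
      field_simp
    · rw [hnorm, div_le_div_iff₀ hj' (by positivity)]
      nlinarith [norm_nonneg w]
    · field_simp
      ring
  have hlim := tendsto_tsum_of_dominated_convergence (f := f) (g := fun _ => (0 : F)) (𝓕 := atTop)
    (summable_geometric_two.mul_right M)
    (fun i => tendsto_choose_smul_fwdDiff_iter hflat i)
    (Eventually.of_forall fun j i => hbound j i)
  rw [tsum_zero] at hlim
  refine tendsto_nhds_unique (tendsto_const_nhds.congr' ?_) hlim
  filter_upwards [eventually_gt_atTop 0] with j hj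
  have hj' : (j : ℝ) ≠ 0 := by exact_mod_cast hj.ne'
  rw [tsum_eq_sum (s := Finset.range (j + 1)), ← shift_eq_sum_fwdDiff_iter,
    ← Nat.cast_smul_eq_nsmul ℝ, smul_inv_smul₀ hj', hw, add_sub_cancel]
  intro i hi
  rw [Finset.mem_range, not_lt] at hi
  simp only [f, Nat.choose_eq_zero_of_lt (show j < i by omega), zero_smul]

end MeanValue

section RadialKernel

variable {E : Type*} [NormedAddCommGroup E] [InnerProductSpace ℝ E] [FiniteDimensional ℝ E]
  [MeasurableSpace E] [BorelSpace E]

theorem exists_radial_kernel [Nontrivial E] :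
    ∃ ζ η : E → ℝ, ContDiff ℝ (⊤ : ℕ∞) ζ ∧ ContDiff ℝ (⊤ : ℕ∞) η ∧
      Function.support ζ ⊆ closedBall 0 1 ∧ Function.support η ⊆ closedBall 0 1 ∧
      ∫ y, η y = 1 ∧ ∀ y v, fderiv ℝ ζ y v = -(η y * inner ℝ y v) := by
  let T : ℝ → ℝ := Real.smoothTransition
  have hT : ContDiff ℝ (⊤ : ℕ∞) T := Real.smoothTransition.contDiff
  have hT' : ContDiff ℝ (⊤ : ℕ∞) (deriv T) := (contDiff_infty_iff_deriv.1 hT).2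
  let q : E → ℝ := fun y => 1 - ‖y‖ ^ 2
  have hq : ContDiff ℝ (⊤ : ℕ∞) q := contDiff_const.sub (contDiff_norm_sq ℝ)
  let η₀ : E → ℝ := fun y => 2 * deriv T (q y)
  have hη₀ : ContDiff ℝ (⊤ : ℕ∞) η₀ := contDiff_const.mul (hT'.comp hq)
  have hqneg : ∀ y : E, y ∉ closedBall (0 : E) 1 → q y < 0 := by
    intro y hy
    rw [mem_closedBall_zero_iff, not_le] at hy
    simp only [q]
    nlinarith
  have hsζ : Function.support (T ∘ q) ⊆ closedBall 0 1 := by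
    intro y hy
    by_contra h
    exact hy (Real.smoothTransition.zero_of_nonpos (hqneg y h).le)
  have hsη : Function.support η₀ ⊆ closedBall 0 1 := by
    intro y hy
    by_contra h
    have hev : T =ᶠ[𝓝 (q y)] fun _ => 0 := by
      filter_upwards [Iio_mem_nhds (hqneg y h)] with s hs
      exact Real.smoothTransition.zero_of_nonpos (le_of_lt hs)
    exact hy (by simp [η₀, hev.deriv_eq])
  have hnonneg : 0 ≤ η₀ := fun y =>
    mul_nonneg zero_le_two (Real.smoothTransition.monotone.deriv_nonneg)
  obtain ⟨c, hc, hcT⟩ := exists_deriv_eq_slope T zero_lt_one hT.continuous.continuousOn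
    (hT.differentiable (by simp)).differentiableOn
  obtain ⟨y₀, hy₀⟩ := exists_norm_eq E (Real.sqrt_nonneg (1 - c))
  have hqy : q y₀ = c := by
    simp only [q]
    rw [hy₀, Real.sq_sqrt (by linarith [hc.2])]
    ring
  have hne : η₀ y₀ ≠ 0 := by
    simp only [η₀, hqy, hcT]
    simp [T]
  have hpos : 0 < ∫ y, η₀ y :=
    hη₀.continuous.integral_pos_of_hasCompactSupport_nonneg_nonzero
      (HasCompactSupport.of_support_subset_isCompact (isCompact_closedBall 0 1) hsη) hnonneg hne
  set I := ∫ y, η₀ y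
  refine ⟨fun y => I⁻¹ * T (q y), fun y => I⁻¹ * η₀ y, contDiff_const.mul (hT.comp hq),
    contDiff_const.mul hη₀, (Function.support_const_smul_subset I⁻¹ (T ∘ q)).trans hsζ,
    (Function.support_const_smul_subset I⁻¹ η₀).trans hsη, ?_, fun y v => ?_⟩
  · rw [integral_const_mul, inv_mul_cancel₀ hpos.ne']
  · have h1 : HasFDerivAt q (-(2 • innerSL ℝ y)) y :=
      (hasStrictFDerivAt_norm_sq y).hasFDerivAt.const_sub 1
    have h2 := ((hT.differentiable (by simp) (q y)).hasDerivAt.comp_hasFDerivAt y h1).const_mul I⁻¹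
    have h3 : fderiv ℝ (fun y => I⁻¹ * T (q y)) y = _ := h2.fderiv
    rw [h3]
    simp [η₀]
    ring

end RadialKernel

section EllipticSystem

variable {ι E F : Type*} [Fintype ι] [NormedAddCommGroup E] [InnerProductSpace ℝ E]
  [FiniteDimensional ℝ E] [MeasurableSpace E] [BorelSpace E]
  [NormedAddCommGroup F] [NormedSpace ℝ F]

theorem hasDerivAt_integral_smul {η : E → ℝ} (hη : Continuous η)
    (hsupp : Function.support η ⊆ closedBall 0 1) {ψ : E → F} (hψ : ContDiff ℝ 2 ψ) (x : E)
    (t : ℝ) :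
    HasDerivAt (fun t => ∫ y, η y • ψ (x + t • y)) (∫ y, η y • fderiv ℝ ψ (x + t • y) y) t := by
  have hψ' : Continuous (fderiv ℝ ψ) := hψ.continuous_fderiv (by simp)
  have hcont : Continuous fun z : ℝ × E => η z.2 • fderiv ℝ ψ (x + z.1 • z.2) z.2 :=
    (hη.comp continuous_snd).smul ((hψ'.comp (by fun_prop)).clm_apply continuous_snd)
  obtain ⟨C, hC⟩ := ((isCompact_closedBall t 1).prod
    (isCompact_closedBall (0 : E) 1)).exists_bound_of_continuousOn hcont.continuousOn
  refine (hasDerivAt_integral_of_dominated_loc_of_deriv_le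
    (F := fun t y => η y • ψ (x + t • y)) (F' := fun t y => η y • fderiv ℝ ψ (x + t • y) y)
    (bound := (closedBall (0 : E) 1).indicator fun _ => C) (closedBall_mem_nhds t one_pos)
    (Eventually.of_forall fun s => ?_) ?_ ?_ ?_ ?_ ?_).2
  · exact (hη.smul (hψ.continuous.comp (by fun_prop))).aestronglyMeasurable
  · exact integrable_smul_of_support_subset hη hsupp (hψ.continuous.comp (by fun_prop))
  · exact (hcont.comp (by fun_prop : Continuous fun y : E => (t, y))).aestronglyMeasurable
  · refine ae_of_all _ fun y s hs => ?_
    by_cases hy : y ∈ closedBall (0 : E) 1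
    · rw [indicator_of_mem hy]
      exact hC (s, y) ⟨hs, hy⟩
    · rw [indicator_of_notMem hy, show η y = 0 from by_contra fun h => hy (hsupp h), zero_smul,
        norm_zero]
  · exact (integrable_indicator_iff measurableSet_closedBall).2
      (integrableOn_const measure_closedBall_lt_top.ne)
  · refine ae_of_all _ fun y s _ => ?_
    have h1 : HasDerivAt (fun s : ℝ => x + s • y) y s := by
      simpa using ((hasDerivAt_id s).smul_const y).const_add x
    exact (((hψ.differentiable (by simp) _).hasFDerivAt.comp_hasDerivAt s h1).const_smul (η y))

theorem hasMeanValueProperty_of_harmonic [CompleteSpace F] {ζ η : E → ℝ} (hζ : ContDiff ℝ (⊤ : ℕ∞) ζ)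
    (hη : Continuous η) (hsζ : Function.support ζ ⊆ closedBall 0 1)
    (hsη : Function.support η ⊆ closedBall 0 1) (h_int : ∫ y, η y = 1)
    (hgrad : ∀ y v, fderiv ℝ ζ y v = -(η y * inner ℝ y v)) (e : OrthonormalBasis ι ℝ E)
    {ψ : E → F} (hψ : ContDiff ℝ 2 ψ) {S : Set E}
    (hharm : ∀ x ∈ S, ∑ j, fderiv ℝ (fderiv ℝ ψ) x (e j) (e j) = 0) :
    HasMeanValueProperty volume η ψ S := by
  intro x R hR hx
  have hψ' : ContDiff ℝ 1 (fderiv ℝ ψ) := hψ.fderiv_right (by norm_num)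
  have hψ'' : Continuous (fderiv ℝ (fderiv ℝ ψ)) := hψ'.continuous_fderiv (by simp)
  have hderiv := hasDerivAt_integral_smul hη hsη hψ x
  have hzero : ∀ t ∈ Icc 0 R, ∫ y, η y • fderiv ℝ ψ (x + t • y) y = 0 := by
    intro t ht
    have hparts : ∀ j, ∫ y, (fderiv ℝ ζ y (e j)) • fderiv ℝ ψ (x + t • y) (e j) =
        -∫ y, ζ y • t • fderiv ℝ (fderiv ℝ ψ) (x + t • y) (e j) (e j) := by
      intro j
      have hg : ∀ y, HasFDerivAt (fun y => fderiv ℝ ψ (x + t • y) (e j))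
          ((ContinuousLinearMap.apply ℝ F (e j)).comp
            ((fderiv ℝ (fderiv ℝ ψ) (x + t • y)).comp (t • ContinuousLinearMap.id ℝ E))) y := by
        intro y
        have h1 : HasFDerivAt (fun y : E => x + t • y) (t • ContinuousLinearMap.id ℝ E) y :=
          ((hasFDerivAt_id y).const_smul t).const_add x
        exact (ContinuousLinearMap.apply ℝ F (e j)).hasFDerivAt.comp y
          ((hψ'.differentiable (by simp) _).hasFDerivAt.comp y h1)
      have hgfd : ∀ y, fderiv ℝ (fun y => fderiv ℝ ψ (x + t • y) (e j)) y (e j) =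
          t • fderiv ℝ (fderiv ℝ ψ) (x + t • y) (e j) (e j) := by
        intro y
        rw [(hg y).fderiv]
        simp
      have hsζ' : Function.support (fun y => fderiv ℝ ζ y (e j)) ⊆ closedBall 0 1 := by
        intro y hy
        refine hsη fun h => hy ?_
        simp [hgrad, h]
      have hζ' : Continuous fun y => fderiv ℝ ζ y (e j) :=
        (hζ.continuous_fderiv (by simp)).clm_apply continuous_const
      have hgc : Continuous fun y => fderiv ℝ ψ (x + t • y) (e j) :=
        (hψ'.continuous.comp (by fun_prop)).clm_apply continuous_const
      have hgc' : Continuous fun y => t • fderiv ℝ (fderiv ℝ ψ) (x + t • y) (e j) (e j) :=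
        continuous_const.smul (((hψ''.comp (by fun_prop)).clm_apply continuous_const).clm_apply
          continuous_const)
      have := integral_smul_fderiv_eq_neg_fderiv_smul_of_integrable (μ := volume) (𝕜 := ℝ) (v := e j)
        (f := ζ) (g := fun y => fderiv ℝ ψ (x + t • y) (e j))
        (integrable_smul_of_support_subset hζ' hsζ' hgc)
        (by simp only [hgfd]; exact integrable_smul_of_support_subset hζ.continuous hsζ hgc')
        (integrable_smul_of_support_subset hζ.continuous hsζ hgc)
        (fun y _ => hζ.differentiable (by simp) y) (fun y _ => (hg y).differentiableAt)
      simp only [hgfd] at this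
      rw [this, neg_neg]
    have hexpand : ∀ y, η y • fderiv ℝ ψ (x + t • y) y =
        -∑ j, (fderiv ℝ ζ y (e j)) • fderiv ℝ ψ (x + t • y) (e j) := by
      intro y
      have hB : ∀ B : E →L[ℝ] F, B y = ∑ j, inner ℝ (e j) y • B (e j) := fun B => by
        conv_lhs => rw [← e.sum_repr' y]
        simp
      rw [hB, Finset.smul_sum, ← Finset.sum_neg_distrib]
      refine Finset.sum_congr rfl fun j _ => ?_
      rw [hgrad, neg_smul, neg_neg, smul_smul, real_inner_comm]
    have hcI : ∀ j, Continuous fun y => fderiv ℝ ψ (x + t • y) (e j) := fun j =>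
        (hψ'.continuous.comp (by fun_prop)).clm_apply continuous_const
    simp only [hexpand]
    rw [integral_neg, integral_finsetSum]
    · simp only [hparts]
      rw [Finset.sum_neg_distrib, neg_neg, ← integral_finsetSum]
      · have : ∀ y, ∑ j, ζ y • t • fderiv ℝ (fderiv ℝ ψ) (x + t • y) (e j) (e j) = 0 := by
          intro y
          by_cases hy : ζ y = 0
          · simp [hy]
          · rw [← Finset.smul_sum, ← Finset.smul_sum, hharm, smul_zero, smul_zero]
            apply hx
            have := mem_closedBall_zero_iff.1 (hsζ hy)
            rw [mem_closedBall, dist_self_add_left, norm_smul, Real.norm_of_nonneg ht.1]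
            nlinarith [ht.1, ht.2, norm_nonneg y]
        simp [this]
      · intro j _
        exact integrable_smul_of_support_subset hζ.continuous hsζ
          (continuous_const.smul (((hψ''.comp (by fun_prop)).clm_apply continuous_const).clm_apply
          continuous_const))
    · intro j _
      refine integrable_smul_of_support_subset
        ((hζ.continuous_fderiv (by simp)).clm_apply continuous_const) (fun y hy => ?_) (hcI j)
      refine hsη fun h => hy ?_
      simp [hgrad, h]
  have hconst := constant_of_has_deriv_right_zero (a := 0) (b := R)
    (f := fun t => ∫ y, η y • ψ (x + t • y))
    (fun t _ => (hderiv t).continuousAt.continuousWithinAt)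
    (fun t ht => by
      have := (hderiv t).hasDerivWithinAt (s := Ici t)
      rwa [hzero t (Ico_subset_Icc_self ht)] at this) R ⟨hR.le, le_rfl⟩
  rw [hconst]
  simp [integral_smul_const, h_int]

end EllipticSystem

/-- A first-order system whose symbol squares to the norm squared has harmonic solutions. -/
theorem sum_fderiv_fderiv_eq_zero {ι E F : Type*} [Fintype ι] [DecidableEq ι]
    [NormedAddCommGroup E] [InnerProductSpace ℝ E] [NormedAddCommGroup F] [NormedSpace ℝ F]
    (e : OrthonormalBasis ι ℝ E) (L : ι → F →L[ℝ] F)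
    (hL : ∀ i j v, L i (L j v) + L j (L i v) = if i = j then (2 : ℝ) • v else 0)
    {ψ : E → F} (hψ : ContDiff ℝ 2 ψ) {U : Set E} (hU : IsOpen U)
    (hsol : ∀ x ∈ U, ∑ j, L j (fderiv ℝ ψ x (e j)) = 0) {x : E} (hx : x ∈ U) :
    ∑ j, fderiv ℝ (fderiv ℝ ψ) x (e j) (e j) = 0 := by
  have hψ' : ContDiff ℝ 1 (fderiv ℝ ψ) := hψ.fderiv_right (by norm_num)
  have hsymm : IsSymmSndFDerivAt ℝ ψ x := hψ.contDiffAt.isSymmSndFDerivAt (by simp)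
  set T := fderiv ℝ (fderiv ℝ ψ) x
  have hT : HasFDerivAt (fderiv ℝ ψ) T x := (hψ'.differentiable (by simp) x).hasFDerivAt
  have h1 : ∀ i, ∑ j, L j (T (e i) (e j)) = 0 := by
    intro i
    have hd : HasFDerivAt (fun y => ∑ j, L j (fderiv ℝ ψ y (e j)))
        (∑ j, (L j).comp ((ContinuousLinearMap.apply ℝ F (e j)).comp T)) x :=
      HasFDerivAt.fun_sum fun j _ => (L j).hasFDerivAt.comp x
        ((ContinuousLinearMap.apply ℝ F (e j)).hasFDerivAt.comp x hT)
    have hz : (fun y => ∑ j, L j (fderiv ℝ ψ y (e j))) =ᶠ[𝓝 x] fun _ => 0 := by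
      filter_upwards [hU.mem_nhds hx] with y hy using hsol y hy
    have := hd.unique ((hasFDerivAt_const (0 : F) x).congr_of_eventuallyEq hz)
    simpa using congrArg (fun B => B (e i)) this
  have h2 : ∑ i, ∑ j, L i (L j (T (e i) (e j))) = 0 := by
    simp [← map_sum, h1]
  have h3 : ∑ i, ∑ j, L j (L i (T (e i) (e j))) = 0 := by
    rw [Finset.sum_comm]
    rw [← h2]
    refine Finset.sum_congr rfl fun i _ => Finset.sum_congr rfl fun j _ => ?_
    rw [hsymm.eq]
  have h4 : ∑ i, ∑ j, (L i (L j (T (e i) (e j))) + L j (L i (T (e i) (e j)))) = 0 := by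
    simp only [Finset.sum_add_distrib, h2, h3, add_zero]
  simp only [hL, Finset.sum_ite_eq, Finset.mem_univ, if_true, ← Finset.smul_sum] at h4
  simpa using h4

section UniqueContinuation

variable {ι E F : Type} [Fintype ι] [DecidableEq ι] [NormedAddCommGroup E] [InnerProductSpace ℝ E]
  [FiniteDimensional ℝ E] [NormedAddCommGroup F] [NormedSpace ℝ F]

theorem exists_contDiff_eqOn_ball {W : Set E} (hW : IsOpen W) {ψ : E → F}
    (hψ : ContDiffOn ℝ (⊤ : ℕ∞) ψ W) {x : E} {ρ : ℝ} (hρ : 0 < ρ)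
    (hx : closedBall x (3 * ρ) ⊆ W) :
    ∃ ψ' : E → F, ContDiff ℝ (⊤ : ℕ∞) ψ' ∧ EqOn ψ' ψ (ball x (2 * ρ)) := by
  let χ : ContDiffBump x := ⟨2 * ρ, 3 * ρ, by positivity, by linarith⟩
  refine ⟨fun y => χ y • ψ y, contDiff_iff_contDiffAt.2 fun y => ?_, fun y hy => ?_⟩
  · by_cases hy : y ∈ W
    · exact χ.contDiffAt.smul (hψ.contDiffAt (hW.mem_nhds hy))
    · have hev : (fun y => χ y • ψ y) =ᶠ[𝓝 y] fun _ => 0 := by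
        have : y ∉ tsupport χ := by
          rw [χ.tsupport_eq]
          exact fun h => hy (hx h)
        filter_upwards [notMem_tsupport_iff_eventuallyEq.1 this] with z hz
        simp [hz]
      exact contDiffAt_const.congr_of_eventuallyEq hev
  · simp only
    rw [χ.one_of_mem_closedBall (ball_subset_closedBall hy), one_smul]

/-- Strong unique continuation for constant coefficient systems of Dirac type. -/
theorem eq_zero_of_isBigO_pow [Nontrivial E] [CompleteSpace F] (e : OrthonormalBasis ι ℝ E)
    (L : ι → F →L[ℝ] F)
    (hL : ∀ i j v, L i (L j v) + L j (L i v) = if i = j then (2 : ℝ) • v else 0)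
    {W : Set E} (hW : IsOpen W) (hconn : IsPreconnected W) {ψ : E → F}
    (hψ : ContDiffOn ℝ (⊤ : ℕ∞) ψ W)
    (hsol : ∀ x ∈ W, ∑ j, L j (fderiv ℝ ψ x (e j)) = 0) {p : E} (hp : p ∈ W)
    (hflat : ∀ k : ℕ, ψ =O[𝓝 p] fun x => ‖x - p‖ ^ k) {x : E} (hx : x ∈ W) : ψ x = 0 := by
  let _ : MeasurableSpace E := borel E
  have : BorelSpace E := ⟨rfl⟩
  obtain ⟨ζ, η, hζ, hη, hsζ, hsη, h_int, hgrad⟩ := exists_radial_kernel (E := E)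
  obtain ⟨K, hK⟩ := hη.lipschitzWith_of_hasCompactSupport
    (HasCompactSupport.of_support_subset_isCompact (isCompact_closedBall 0 1) hsη) (by simp)
  set A : ℝ := 18 * (K * (volume : Measure E).real (closedBall 0 2) + 1)
  have hA : 0 < A := by positivity
  have hlocal : ∀ z ρ, 0 < ρ → closedBall z (3 * ρ) ⊆ W →
      (∀ k : ℕ, ψ =O[𝓝 z] fun x => ‖x - z‖ ^ k) → ∀ y, A * ‖y - z‖ ≤ ρ → ψ y = 0 := by
    intro z ρ hρ hz hfl y hy
    obtain ⟨ψ', hψ', heq⟩ := exists_contDiff_eqOn_ball hW hψ hρ hz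
    have hsub : closedBall z ρ ⊆ ball z (2 * ρ) := closedBall_subset_ball (by linarith)
    have hψ2 : ContDiff ℝ 2 ψ' := mod_cast contDiff_infty.1 hψ' 2
    have hev : ∀ w ∈ ball z (2 * ρ), ψ' =ᶠ[𝓝 w] ψ := fun w hw =>
      heq.eventuallyEq_of_mem (isOpen_ball.mem_nhds hw)
    have hmean : HasMeanValueProperty volume η ψ' (closedBall z ρ) := by
      refine hasMeanValueProperty_of_harmonic hζ hη.continuous hsζ hsη h_int hgrad e hψ2
        fun w hw => sum_fderiv_fderiv_eq_zero e L hL hψ2 isOpen_ball (fun v hv => ?_) (hsub hw)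
      rw [(hev v hv).fderiv_eq]
      exact hsol v (hz (ball_subset_closedBall (ball_subset_ball (by linarith) hv)))
    have hy' : y ∈ ball z (2 * ρ) := by
      apply hsub
      rw [mem_closedBall, dist_eq_norm]
      have : 1 ≤ A := by
        have : 0 ≤ K * (volume : Measure E).real (closedBall 0 2) := by positivity
        simp only [A]
        linarith
      nlinarith [norm_nonneg (y - z)]
    rw [← heq hy']
    refine eq_zero_of_hasMeanValueProperty hK hsη hψ'.continuous hρ hmean
      (fun k => (hfl k).congr' (hev z (mem_ball_self (by linarith))).symm .rfl) ?_
    simp only [A] at hy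
    linarith
  have hflat0 : ∀ z, ψ =ᶠ[𝓝 z] (fun _ => 0) → ∀ k : ℕ, ψ =O[𝓝 z] fun x => ‖x - z‖ ^ k :=
    fun z hz k => (Asymptotics.isBigO_zero _ _).congr' hz.symm .rfl
  have hnhds : ∀ z ρ, 0 < ρ → closedBall z (3 * ρ) ⊆ W →
      (∀ k : ℕ, ψ =O[𝓝 z] fun x => ‖x - z‖ ^ k) → ∀ y, A * ‖y - z‖ < ρ →
      ψ =ᶠ[𝓝 y] fun _ => 0 := by
    intro z ρ hρ hz hfl y hy
    have hopen : IsOpen {y | A * ‖y - z‖ < ρ} := isOpen_lt (by fun_prop) continuous_const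
    filter_upwards [hopen.mem_nhds hy] with y' hy'
    exact hlocal z ρ hρ hz hfl y' (le_of_lt hy')
  have hball : ∀ z ∈ W, ∃ ρ, 0 < ρ ∧ closedBall z (4 * ρ) ⊆ W := by
    intro z hz
    obtain ⟨r, hr, hrW⟩ := Metric.nhds_basis_closedBall.mem_iff.1 (hW.mem_nhds hz)
    exact ⟨r / 4, by positivity, by rwa [mul_div_cancel₀ _ (by norm_num)]⟩
  have hmain : W ⊆ {z | ψ =ᶠ[𝓝 z] fun _ => 0} := by
    refine hconn.subset_of_closure_inter_subset isOpen_setOfPred_eventually_nhds ⟨p, hp, ?_⟩ ?_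
    · obtain ⟨ρ, hρ, hsub⟩ := hball p hp
      exact hnhds p ρ hρ ((closedBall_subset_closedBall (by linarith)).trans hsub) hflat p
        (by simpa using hρ)
    · rintro y ⟨hy, hyW⟩
      obtain ⟨ρ, hρ, hsub⟩ := hball y hyW
      obtain ⟨z, hz, hyz⟩ := Metric.mem_closure_iff.1 hy (min ρ (ρ / A)) (by positivity)
      refine hnhds z ρ hρ ((closedBall_subset_closedBall' ?_).trans hsub) (hflat0 z hz) y ?_
      · rw [dist_comm]
        linarith [hyz.trans_le (min_le_left _ _)]
      · rw [← dist_eq_norm, mul_comm, ← lt_div_iff₀ hA]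
        exact hyz.trans_le (min_le_right _ _)
  exact (hmain hx).self_of_nhds

end UniqueContinuation

theorem exists_clifford_matrices_fintype (n : ℕ) :
    ∃ (κ : Type) (_ : Fintype κ) (_ : DecidableEq κ) (_ : Nonempty κ) (S : Fin n → Matrix κ κ ℝ),
      ∀ i j, S i * S j + S j * S i = if i = j then (2 : ℝ) • 1 else 0 := by
  induction n with
  | zero => exact ⟨Unit, inferInstance, inferInstance, inferInstance, Fin.elim0, fun i => i.elim0⟩
  | succ n ih =>
    obtain ⟨κ, _, _, _, S, hS⟩ := ih
    refine ⟨κ ⊕ κ, inferInstance, inferInstance, inferInstance,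
      Fin.cons (Matrix.fromBlocks 1 0 0 (-1)) fun i => Matrix.fromBlocks 0 (S i) (S i) 0,
      fun i j => ?_⟩
    cases i using Fin.cases <;> cases j using Fin.cases
    · simp [Matrix.fromBlocks_multiply, two_smul]
    · simp [Matrix.fromBlocks_multiply, Matrix.fromBlocks_add, (Fin.succ_ne_zero _).symm]
    · simp [Matrix.fromBlocks_multiply, Matrix.fromBlocks_add, Fin.succ_ne_zero]
    · simp only [Fin.cons_succ, Matrix.fromBlocks_multiply, Matrix.fromBlocks_add,
        Fin.succ_inj]
      simp only [zero_mul, mul_zero, zero_add, add_zero, hS]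
      split_ifs
      · rw [← Matrix.fromBlocks_one, Matrix.fromBlocks_smul, smul_zero]
      · exact Matrix.fromBlocks_zero

theorem exists_clifford_matrices (n : ℕ) :
    ∃ N : ℕ, 1 ≤ N ∧ ∃ S : Fin n → Matrix (Fin N) (Fin N) ℝ,
      ∀ i j, S i * S j + S j * S i = if i = j then (2 : ℝ) • 1 else 0 := by
  obtain ⟨κ, _, _, _, S, hS⟩ := exists_clifford_matrices_fintype n
  let f := Matrix.reindexAlgEquiv ℝ ℝ (Fintype.equivFin κ)
  refine ⟨Fintype.card κ, Fintype.card_pos, fun i => f (S i), fun i j => ?_⟩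
  rw [← map_mul, ← map_mul, ← map_add, hS]
  split_ifs <;> simp

section Clifford

variable {n N : ℕ} {S : Fin n → Matrix (Fin N) (Fin N) ℝ}

theorem sum_smul_mul_self (hS : ∀ i j, S i * S j + S j * S i = if i = j then (2 : ℝ) • 1 else 0)
    (c : Fin n → ℝ) :
    (∑ i, c i • S i) * (∑ i, c i • S i) = (∑ i, c i ^ 2) • 1 := by
  have h1 : (∑ i, c i • S i) * (∑ i, c i • S i) = ∑ i, ∑ j, (c i * c j) • (S i * S j) := by
    simp only [Finset.sum_mul, Finset.mul_sum, smul_mul_smul_comm]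
    rw [Finset.sum_comm]
  have h2 : (∑ i, c i • S i) * (∑ i, c i • S i) = ∑ i, ∑ j, (c i * c j) • (S j * S i) := by
    rw [h1, Finset.sum_comm]
    simp only [mul_comm]
  have h3 : (2 : ℝ) • ((∑ i, c i • S i) * (∑ i, c i • S i)) = (2 : ℝ) • (∑ i, c i ^ 2) • 1 := by
    rw [two_smul]
    nth_rewrite 1 [h1]
    rw [h2]
    simp only [← Finset.sum_add_distrib, ← smul_add, hS, smul_ite, smul_zero, Finset.sum_ite_eq,
      Finset.mem_univ, if_true, Finset.sum_smul, Finset.smul_sum]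
    refine Finset.sum_congr rfl fun i _ => ?_
    rw [smul_comm, pow_two]
  exact smul_right_injective _ two_ne_zero h3

theorem isUnit_sum_smul (hS : ∀ i j, S i * S j + S j * S i = if i = j then (2 : ℝ) • 1 else 0)
    {c : Fin n → ℝ} (hc : c ≠ 0) : IsUnit (∑ i, c i • S i) := by
  obtain ⟨i, hi⟩ := Function.ne_iff.1 hc
  have hpos : 0 < ∑ i, c i ^ 2 :=
    Finset.sum_pos' (fun i _ => sq_nonneg _) ⟨i, Finset.mem_univ i, sq_pos_of_ne_zero hi⟩
  have h := sum_smul_mul_self hS c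
  refine IsUnit.of_mul_eq_one ((∑ i, c i ^ 2)⁻¹ • ∑ i, c i • S i) ?_
  rw [mul_smul_comm, h, inv_smul_smul₀ hpos.ne']

end Clifford

section DiracSystems

variable {m N : ℕ} {S : Fin (m + 2) → Matrix (Fin N) (Fin N) ℝ}

/-- Strong unique continuation for the Dirac type system `∑ⱼ Sⱼ ∂ψ/∂xⱼ = 0`. -/
theorem eq_zero_of_dirac (hS : ∀ i j, S i * S j + S j * S i = if i = j then (2 : ℝ) • 1 else 0)
    {W : Set (Euc (m + 2))} (hW : IsOpen W) (hconn : IsPreconnected W)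
    {ψ : Euc (m + 2) → Fin N → ℝ} (hψ : ContDiffOn ℝ (⊤ : ℕ∞) ψ W)
    (hsol : ∀ x ∈ W, ∑ j, (S j).mulVec (fderiv ℝ ψ x (EuclideanSpace.single j 1)) = 0)
    {p : Euc (m + 2)} (hp : p ∈ W) (hflat : ∀ k : ℕ, ψ =O[𝓝 p] fun x => ‖x - p‖ ^ k)
    {x : Euc (m + 2)} (hx : x ∈ W) : ψ x = 0 := by
  refine eq_zero_of_isBigO_pow (EuclideanSpace.basisFun (Fin (m + 2)) ℝ)
    (fun j => (S j).mulVecLin.toContinuousLinearMap) (fun i j v => ?_) hW hconn hψ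
    (fun x hx => ?_) hp hflat hx
  · have := congrArg (fun M => M.mulVec v) (hS i j)
    simp only [Matrix.add_mulVec, ← Matrix.mulVec_mulVec] at this
    refine this.trans ?_
    split_ifs <;> simp [Matrix.smul_mulVec]
  · simpa using hsol x hx

/-- The principal coefficients of the Dirac operator conjugated by the shear
`y ↦ y + G y • e₀`, where `∂G/∂x₀ = 0`. -/
def shearedSymbol (S : Fin (m + 2) → Matrix (Fin N) (Fin N) ℝ) (G : Euc (m + 2) → ℝ)
    (j : Fin (m + 2)) (x : Euc (m + 2)) : Matrix (Fin N) (Fin N) ℝ :=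
  S j + if j = 0 then ∑ k, fderiv ℝ G x (EuclideanSpace.single k 1) • S k else 0

theorem sum_shearedSymbol_mulVec (G : Euc (m + 2) → ℝ) (x : Euc (m + 2))
    (T : Euc (m + 2) →L[ℝ] Fin N → ℝ) :
    ∑ j, (shearedSymbol S G j x).mulVec (T (EuclideanSpace.single j 1)) =
      ∑ j, (S j).mulVec (T (EuclideanSpace.single j 1 +
        fderiv ℝ G x (EuclideanSpace.single j 1) • EuclideanSpace.single 0 1)) := by
  simp only [shearedSymbol, Matrix.add_mulVec, Finset.sum_add_distrib, map_add, Matrix.mulVec_add,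
    map_smul, Matrix.mulVec_smul]
  congr 1
  rw [Finset.sum_eq_single_of_mem 0 (Finset.mem_univ _) fun j _ hj => by simp [hj]]
  simp only [if_true, Matrix.sum_mulVec, Matrix.smul_mulVec]

theorem isUnit_sum_shearedSymbol
    (hS : ∀ i j, S i * S j + S j * S i = if i = j then (2 : ℝ) • 1 else 0)
    {G : Euc (m + 2) → ℝ} {x : Euc (m + 2)}
    (hG : fderiv ℝ G x (EuclideanSpace.single 0 1) = 0) {ξ : Euc (m + 2)} (hξ : ξ ≠ 0) :
    IsUnit (∑ j, ξ j • shearedSymbol S G j x) := by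
  have h : ∑ j, ξ j • shearedSymbol S G j x =
      ∑ k, (ξ k + ξ 0 * fderiv ℝ G x (EuclideanSpace.single k 1)) • S k := by
    simp only [shearedSymbol, smul_add, add_smul, Finset.sum_add_distrib]
    congr 1
    rw [Finset.sum_eq_single_of_mem 0 (Finset.mem_univ _) fun j _ hj => by simp [hj]]
    simp only [if_true, Finset.smul_sum, smul_smul]
  rw [h]
  refine isUnit_sum_smul hS fun h0 => hξ ?_
  have hξ0 : ξ 0 = 0 := by simpa [hG] using congrFun h0 0
  ext k
  simpa [hξ0] using congrFun h0 k

/-- Strong unique continuation for the sheared Dirac system. -/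
theorem eq_zero_of_sheared_dirac
    (hS : ∀ i j, S i * S j + S j * S i = if i = j then (2 : ℝ) • 1 else 0)
    {G : Euc (m + 2) → ℝ} (hG : ContDiff ℝ (⊤ : ℕ∞) G)
    (hG0 : ∀ x (t : ℝ), G (x + t • EuclideanSpace.single 0 1) = G x)
    {W : Set (Euc (m + 2))} (hW : IsOpen W) (hconn : IsPreconnected W)
    {ψ : Euc (m + 2) → Fin N → ℝ} (hψ : ContDiffOn ℝ (⊤ : ℕ∞) ψ W)
    (hsol : ∀ x ∈ W,
      ∑ j, (shearedSymbol S G j x).mulVec (fderiv ℝ ψ x (EuclideanSpace.single j 1)) = 0)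
    {p : Euc (m + 2)} (hp : p ∈ W) (hflat : ∀ k : ℕ, ψ =O[𝓝 p] fun x => ‖x - p‖ ^ k)
    {x : Euc (m + 2)} (hx : x ∈ W) : ψ x = 0 := by
  set e₀ : Euc (m + 2) := EuclideanSpace.single 0 1
  let Ψ : Euc (m + 2) → Euc (m + 2) := fun y => y + G y • e₀
  let Φ : Euc (m + 2) → Euc (m + 2) := fun y => y + (-G y) • e₀
  have hΨ : ContDiff ℝ (⊤ : ℕ∞) Ψ := contDiff_id.add (hG.smul contDiff_const)
  have hΦ : ContDiff ℝ (⊤ : ℕ∞) Φ := contDiff_id.add (hG.neg.smul contDiff_const)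
  have hGd : Differentiable ℝ G := hG.differentiable (by simp)
  have hΨd : ∀ y, HasFDerivAt Ψ
      (ContinuousLinearMap.id ℝ _ + (fderiv ℝ G y).smulRight e₀) y := fun y =>
    (hasFDerivAt_id y).add ((hGd y).hasFDerivAt.smul_const e₀)
  have hΨΦ : ∀ y, Ψ (Φ y) = y := fun y => by
    simp only [Ψ, Φ, hG0]
    module
  have hΦΨ : ∀ y, Φ (Ψ y) = y := fun y => by
    simp only [Ψ, Φ, hG0]
    module
  have hdG : ∀ y, fderiv ℝ G (Ψ y) = fderiv ℝ G y := fun y => by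
    have h : (fun z => G (z + G y • e₀)) = G := funext fun z => hG0 z _
    rw [← fderiv_comp_add_right, h]
  have himage : Φ '' W = Ψ ⁻¹' W :=
    congrFun (image_eq_preimage_of_inverse hΨΦ hΦΨ) W
  have hmaps : ∀ {z}, z ∈ W → Φ z ∈ Ψ ⁻¹' W := fun {z} hz => by simpa [hΨΦ] using hz
  rw [← hΨΦ x]
  refine eq_zero_of_dirac (ψ := ψ ∘ Ψ) hS (hW.preimage hΨ.continuous)
    (himage ▸ hconn.image Φ hΦ.continuous.continuousOn)
    (hψ.comp hΨ.contDiffOn fun _ h => h) (fun y hy => ?_) (hmaps hp) (fun k => ?_) (hmaps hx)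
  · have hψy : DifferentiableAt ℝ ψ (Ψ y) :=
      (hψ.contDiffAt (hW.mem_nhds hy)).differentiableAt (by simp)
    have h := hsol (Ψ y) hy
    rw [sum_shearedSymbol_mulVec, hdG] at h
    rw [(hψy.hasFDerivAt.comp y (hΨd y)).fderiv]
    simpa using h
  · have ht : Tendsto Ψ (𝓝 (Φ p)) (𝓝 p) := by
      simpa [hΨΦ] using hΨ.continuous.tendsto (Φ p)
    have hO : (fun y => Ψ y - p) =O[𝓝 (Φ p)] fun y => y - Φ p := by
      simpa [hΨΦ] using (hΨd (Φ p)).isBigO_sub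
    exact ((hflat k).comp_tendsto ht).trans (hO.norm_norm.pow k)

end DiracSystems

section BlockSum

variable {n N : ℕ}

/-- The block diagonal matrix `diag(A, B)` indexed by `Fin (N + N)`. -/
def blockSum (A B : Matrix (Fin N) (Fin N) ℝ) : Matrix (Fin (N + N)) (Fin (N + N)) ℝ :=
  Matrix.reindexAlgEquiv ℝ ℝ finSumFinEquiv (Matrix.fromBlocks A 0 0 B)

theorem isUnit_blockSum {A B : Matrix (Fin N) (Fin N) ℝ} (hA : IsUnit A) (hB : IsUnit B) :
    IsUnit (blockSum A B) :=
  (Matrix.isUnit_fromBlocks_zero₂₁.2 ⟨hA, hB⟩).map _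

theorem sum_smul_blockSum (c : Fin n → ℝ) (A B : Fin n → Matrix (Fin N) (Fin N) ℝ) :
    ∑ j, c j • blockSum (A j) (B j) = blockSum (∑ j, c j • A j) (∑ j, c j • B j) := by
  simp only [blockSum, ← map_smul, ← map_sum]
  congr 1
  ext (i | i) (j | j) <;> simp [Matrix.sum_apply]

theorem blockSum_mulVec_append (A B : Matrix (Fin N) (Fin N) ℝ) (v w : Fin N → ℝ) :
    (blockSum A B).mulVec (Fin.append v w) = Fin.append (A.mulVec v) (B.mulVec w) := by
  ext i
  cases i using Fin.addCases <;>
    simp [blockSum, Matrix.mulVec, dotProduct, Fin.sum_univ_add, -Fin.natAdd_eq_addNat]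

/-- Concatenation of vectors as a continuous linear equivalence. -/
def appendCLE (N : ℕ) : ((Fin N → ℝ) × (Fin N → ℝ)) ≃L[ℝ] (Fin (N + N) → ℝ) :=
  LinearEquiv.toContinuousLinearEquiv
    { Fin.appendEquiv N N with
      map_add' := fun v w => by
        ext i
        cases i using Fin.addCases <;> simp [Fin.appendEquiv, -Fin.natAdd_eq_addNat]
      map_smul' := fun c v => by
        ext i
        cases i using Fin.addCases <;> simp [Fin.appendEquiv, -Fin.natAdd_eq_addNat] }

theorem appendCLE_apply (v w : Fin N → ℝ) : appendCLE N (v, w) = Fin.append v w := rfl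

theorem linApply_blockSum (A A' : Fin n → Euc n → Matrix (Fin N) (Fin N) ℝ)
    {ψ ψ' : Euc n → Fin N → ℝ} {x : Euc n} (hψ : DifferentiableAt ℝ ψ x)
    (hψ' : DifferentiableAt ℝ ψ' x) :
    linApply (fun j x => blockSum (A j x) (A' j x)) 0 (fun x => appendCLE N (ψ x, ψ' x)) x =
      appendCLE N (∑ j, (A j x).mulVec (fderiv ℝ ψ x (EuclideanSpace.single j 1)),
        ∑ j, (A' j x).mulVec (fderiv ℝ ψ' x (EuclideanSpace.single j 1))) := by
  have h : HasFDerivAt (fun x => appendCLE N (ψ x, ψ' x)) _ x :=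
    (appendCLE N).hasFDerivAt.comp x (hψ.hasFDerivAt.prodMk hψ'.hasFDerivAt)
  simp only [linApply, h.fderiv]
  simp only [Pi.zero_apply, Matrix.zero_mulVec, add_zero, ContinuousLinearMap.comp_apply,
    ContinuousLinearEquiv.coe_coe, ContinuousLinearMap.prod_apply, appendCLE_apply,
    blockSum_mulVec_append]
  simp only [← appendCLE_apply, ← map_sum]
  congr 1
  ext1 <;> simp [Prod.fst_sum, Prod.snd_sum]

end BlockSum

section ShearedPair

variable {m N : ℕ} {S : Fin (m + 2) → Matrix (Fin N) (Fin N) ℝ} {G : Euc (m + 2) → ℝ}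

theorem fderiv_single_eq_zero
    (hG : ContDiff ℝ (⊤ : ℕ∞) G)
    (hG0 : ∀ x (t : ℝ), G (x + t • EuclideanSpace.single 0 1) = G x) (x : Euc (m + 2)) :
    fderiv ℝ G x (EuclideanSpace.single 0 1) = 0 := by
  rw [← ((hG.differentiable (by simp)) x).lineDeriv_eq_fderiv, lineDeriv]
  simp [hG0]

/-- The coefficients of the direct sum of a constant coefficient Dirac operator and a sheared
one. -/
def pairSymbol (S : Fin (m + 2) → Matrix (Fin N) (Fin N) ℝ) (G : Euc (m + 2) → ℝ)
    (j : Fin (m + 2)) (x : Euc (m + 2)) : Matrix (Fin (N + N)) (Fin (N + N)) ℝ :=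
  blockSum (shearedSymbol S 0 j x) (shearedSymbol S G j x)

theorem contDiff_shearedSymbol (hG : ContDiff ℝ (⊤ : ℕ∞) G) (j i l) :
    ContDiff ℝ (⊤ : ℕ∞) fun x => shearedSymbol S G j x i l := by
  have h : ContDiff ℝ (⊤ : ℕ∞) (fderiv ℝ G) := hG.fderiv_right (by simp)
  unfold shearedSymbol
  split_ifs
  · simp only [Matrix.add_apply, Matrix.sum_apply, Matrix.smul_apply, smul_eq_mul]
    fun_prop
  · simpa using contDiff_const

theorem contDiff_pairSymbol (hG : ContDiff ℝ (⊤ : ℕ∞) G) (j i l) :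
    ContDiff ℝ (⊤ : ℕ∞) fun x => pairSymbol S G j x i l := by
  simp only [pairSymbol, blockSum, Matrix.coe_reindexAlgEquiv, Matrix.reindex_apply,
    Matrix.submatrix_apply]
  rcases finSumFinEquiv.symm i with i | i <;> rcases finSumFinEquiv.symm l with l | l
  · exact contDiff_shearedSymbol contDiff_const j i l
  · exact contDiff_const
  · exact contDiff_const
  · exact contDiff_shearedSymbol hG j i l

theorem hasSUCPlin_pairSymbol
    (hS : ∀ i j, S i * S j + S j * S i = if i = j then (2 : ℝ) • 1 else 0)
    (hG : ContDiff ℝ (⊤ : ℕ∞) G)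
    (hG0 : ∀ x (t : ℝ), G (x + t • EuclideanSpace.single 0 1) = G x) :
    HasSUCPlin (pairSymbol S G) 0 := by
  rintro W hW hconn ψ hψ hsol ⟨p, hp, hflat⟩ x hx
  let P := (appendCLE N).symm.toContinuousLinearMap
  let P₁ := (ContinuousLinearMap.fst ℝ (Fin N → ℝ) (Fin N → ℝ)).comp P
  let P₂ := (ContinuousLinearMap.snd ℝ (Fin N → ℝ) (Fin N → ℝ)).comp P
  have hP : ∀ v, appendCLE N (P₁ v, P₂ v) = v := fun v => (appendCLE N).apply_symm_apply v
  have hO : ∀ k : ℕ, ψ =O[𝓝 p] fun x => ‖x - p‖ ^ k := fun k =>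
    isBigO_pow_of_iteratedFDeriv_eq_zero p k (hψ.contDiffAt (hW.mem_nhds hp)) hflat
  have hs : ∀ y ∈ W,
      (∑ j, (shearedSymbol S 0 j y).mulVec
        (fderiv ℝ (P₁ ∘ ψ) y (EuclideanSpace.single j 1)),
      ∑ j, (shearedSymbol S G j y).mulVec
        (fderiv ℝ (P₂ ∘ ψ) y (EuclideanSpace.single j 1))) = 0 := fun y hy => by
    have hd : DifferentiableAt ℝ ψ y :=
      (hψ.contDiffAt (hW.mem_nhds hy)).differentiableAt (by simp)
    have h := linApply_blockSum (shearedSymbol S 0) (shearedSymbol S G)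
      (P₁.differentiableAt.comp y hd) (P₂.differentiableAt.comp y hd)
    simp only [Function.comp_apply, hP] at h
    exact (appendCLE N).map_eq_zero_iff.1 (h.symm.trans (hsol y hy))
  have h₁ : P₁ (ψ x) = 0 := eq_zero_of_sheared_dirac hS contDiff_const (fun _ _ => rfl) hW
    hconn.isPreconnected (P₁.contDiff.comp_contDiffOn hψ) (fun y hy => congrArg Prod.fst (hs y hy))
    hp (fun k => (P₁.isBigO_comp ψ _).trans (hO k)) hx
  have h₂ : P₂ (ψ x) = 0 := eq_zero_of_sheared_dirac hS hG hG0 hW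
    hconn.isPreconnected (P₂.contDiff.comp_contDiffOn hψ) (fun y hy => congrArg Prod.snd (hs y hy))
    hp (fun k => (P₂.isBigO_comp ψ _).trans (hO k)) hx
  rw [← hP (ψ x), h₁, h₂]
  exact map_zero _

/-- A solution of the sheared Dirac system which vanishes exactly on `{x₀ = G x, x₁ = 0}`. -/
def shearedSolution (S : Fin (m + 2) → Matrix (Fin N) (Fin N) ℝ) (G : Euc (m + 2) → ℝ)
    (x : Euc (m + 2)) : Fin N → ℝ :=
  (x 0 - G x) • (S 0).mulVec 1 - x 1 • (S 1).mulVec 1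

theorem contDiff_shearedSolution (hG : ContDiff ℝ (⊤ : ℕ∞) G) :
    ContDiff ℝ (⊤ : ℕ∞) (shearedSolution S G) := by
  unfold shearedSolution
  fun_prop

theorem shearedSolution_eq_zero_iff [NeZero N]
    (hS : ∀ i j, S i * S j + S j * S i = if i = j then (2 : ℝ) • 1 else 0) {x : Euc (m + 2)} :
    shearedSolution S G x = 0 ↔ x 0 = G x ∧ x 1 = 0 := by
  refine ⟨fun h => ?_, fun h => by simp [shearedSolution, h.1, h.2]⟩
  by_contra hne
  let c : Fin (m + 2) → ℝ := Fin.cons (x 0 - G x) (Fin.cons (-x 1) 0)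
  have hc : c ≠ 0 := fun hc => hne
    ⟨sub_eq_zero.1 (congrFun hc 0), neg_eq_zero.1 (congrFun hc 1)⟩
  have hsum : (∑ i, c i • S i).mulVec 1 = 0 := by
    rw [← h]
    simp [c, Fin.sum_univ_succ, Matrix.add_mulVec, Matrix.smul_mulVec, shearedSolution,
      Matrix.neg_mulVec, sub_eq_add_neg]
  have h1 : (1 : Fin N → ℝ) = 0 :=
    Matrix.mulVec_injective_of_isUnit (isUnit_sum_smul hS hc)
      (hsum.trans (Matrix.mulVec_zero _).symm)
  simpa using congrFun h1 0

theorem sum_shearedSymbol_mulVec_shearedSolution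
    (hS : ∀ i j, S i * S j + S j * S i = if i = j then (2 : ℝ) • 1 else 0)
    (hG : ContDiff ℝ (⊤ : ℕ∞) G)
    (hG0 : ∀ x (t : ℝ), G (x + t • EuclideanSpace.single 0 1) = G x) (x : Euc (m + 2)) :
    ∑ j, (shearedSymbol S G j x).mulVec
      (fderiv ℝ (shearedSolution S G) x (EuclideanSpace.single j 1)) = 0 := by
  have hsq : ∀ i, S i * S i = 1 := fun i => by
    have h := hS i i
    rw [if_pos rfl, ← two_smul ℝ] at h
    exact smul_right_injective _ two_ne_zero h
  have hp : ∀ i, HasFDerivAt (fun x : Euc (m + 2) => x i)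
      (EuclideanSpace.proj i : Euc (m + 2) →L[ℝ] ℝ) x := fun i =>
    (EuclideanSpace.proj i : Euc (m + 2) →L[ℝ] ℝ).hasFDerivAt
  have hd : HasFDerivAt (shearedSolution S G) _ x :=
    (((hp 0).sub ((hG.differentiable (by simp)) x).hasFDerivAt).smul_const _).sub
      ((hp 1).smul_const _)
  rw [sum_shearedSymbol_mulVec, hd.fderiv]
  have h0 := fderiv_single_eq_zero hG hG0 x
  have hj : ∀ j : Fin (m + 2), ((EuclideanSpace.proj 0 - fderiv ℝ G x).smulRight
      ((S 0).mulVec 1) - (EuclideanSpace.proj 1 : Euc (m + 2) →L[ℝ] ℝ).smulRight ((S 1).mulVec 1))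
      (EuclideanSpace.single j 1 +
        fderiv ℝ G x (EuclideanSpace.single j 1) • EuclideanSpace.single 0 1) =
      (if 0 = j then (S 0).mulVec 1 else 0) - if 1 = j then (S 1).mulVec 1 else 0 := fun j => by
    simp [h0]
  simp [hj, Matrix.mulVec_sub, apply_ite ((S _).mulVec), hsq]

end ShearedPair

/-- Embedding a set into `ℝᵐ⁺²` as a coordinate slice preserves its Hausdorff dimension. -/
theorem dimH_setOf_eq_zero {m : ℕ} (K : Set (Fin m → ℝ)) :
    dimH {x : Euc (m + 2) | x 0 = 0 ∧ x 1 = 0 ∧ (fun i : Fin m => x i.succ.succ) ∈ K} =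
      dimH K := by
  let π : Euc (m + 2) →L[ℝ] Fin m → ℝ :=
    ContinuousLinearMap.pi fun i => EuclideanSpace.proj i.succ.succ
  let ι : (Fin m → ℝ) →L[ℝ] Euc (m + 2) := LinearMap.toContinuousLinearMap
    { toFun := fun y => WithLp.toLp 2 (Fin.cons 0 (Fin.cons 0 y))
      map_add' := fun y z => by
        ext i
        cases i using Fin.cases with
        | zero => simp
        | succ i => cases i using Fin.cases <;> simp
      map_smul' := fun c y => by
        ext i
        cases i using Fin.cases with
        | zero => simp
        | succ i => cases i using Fin.cases <;> simp }
  refine le_antisymm ((dimH_mono fun x hx => ?_).trans (ι.lipschitz.dimH_image_le K))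
    ((dimH_mono fun y hy => ?_).trans (π.lipschitz.dimH_image_le _))
  · refine ⟨_, hx.2.2, ?_⟩
    ext i
    cases i using Fin.cases with
    | zero => exact hx.1.symm
    | succ i =>
      cases i using Fin.cases with
      | zero => exact hx.2.1.symm
      | succ i => rfl
  · exact ⟨ι y, ⟨rfl, rfl, hy⟩, rfl⟩

/-- For `n ≥ 3` and any real `0 ≤ d ≤ n − 2` there exist a linear
elliptic first-order operator on `ℝⁿ` with smooth coefficients and the strong unique
continuation property and a nontrivial solution `φ` whose zero set has Hausdorff
dimension exactly `d`. -/
theorem exists_solution_with_zero_set_of_any_hausdorff_dimension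
    (n : ℕ) (hn : 3 ≤ n)
    (d : ℝ) (hd0 : 0 ≤ d) (hdn : d ≤ (n : ℝ) - 2) :
    ∃ N : ℕ, 1 ≤ N ∧
    ∃ (C : Fin n → Euc n → Matrix (Fin N) (Fin N) ℝ)
      (B : Euc n → Matrix (Fin N) (Fin N) ℝ),
      (∀ j i l, ContDiff ℝ (⊤ : ℕ∞) (fun x => C j x i l)) ∧
      (∀ i l, ContDiff ℝ (⊤ : ℕ∞) (fun x => B x i l)) ∧
      (∀ x ξ : Euc n, ξ ≠ 0 → IsUnit (∑ j, ξ j • C j x)) ∧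
      HasSUCPlin C B ∧
      ∃ φ : Euc n → (Fin N → ℝ), ContDiff ℝ (⊤ : ℕ∞) φ ∧
        (∀ x, linApply C B φ x = 0) ∧ (∃ x, φ x ≠ 0) ∧
        dimH {x : Euc n | φ x = 0} = ENNReal.ofReal d := by
  obtain ⟨m, rfl⟩ : ∃ m, n = m + 2 := ⟨n - 2, by omega⟩
  obtain ⟨K, hK, hdim⟩ := exists_isClosed_dimH_eq m (by omega) hd0
    (by push_cast at hdn; linarith)
  obtain ⟨N, hN, S, hS⟩ := exists_clifford_matrices (m + 2)
  have : NeZero N := ⟨by omega⟩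
  obtain ⟨g, hgK, hg, -⟩ :=
    hK.isOpen_compl.exists_contDiff_support_eq (n := ⊤)
  have hg0 : ∀ y, g y = 0 ↔ y ∈ K := fun y => by
    rw [← Function.notMem_support, hgK, notMem_compl_iff]
  let G : Euc (m + 2) → ℝ := fun x => g fun i => x i.succ.succ
  have hG : ContDiff ℝ (⊤ : ℕ∞) G := hg.comp (by fun_prop)
  have hG0 : ∀ x (t : ℝ), G (x + t • EuclideanSpace.single 0 1) = G x := fun x t => by
    simp [G]
  have hz : ContDiff ℝ (⊤ : ℕ∞) (0 : Euc (m + 2) → ℝ) := contDiff_const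
  have hφ : ∀ x : Euc (m + 2),
      appendCLE N (shearedSolution S 0 x, shearedSolution S G x) = 0 ↔
        x 0 = 0 ∧ x 1 = 0 ∧ (fun i : Fin m => x i.succ.succ) ∈ K := fun x => by
    rw [ContinuousLinearEquiv.map_eq_zero_iff, Prod.mk_eq_zero, shearedSolution_eq_zero_iff hS,
      shearedSolution_eq_zero_iff hS, ← hg0]
    constructor
    · rintro ⟨⟨h0, h1⟩, h2, -⟩
      exact ⟨h0, h1, h2.symm.trans h0⟩
    · rintro ⟨h0, h1, h2⟩
      exact ⟨⟨h0, h1⟩, h0.trans h2.symm, h1⟩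
  refine ⟨N + N, by omega, pairSymbol S G, 0, contDiff_pairSymbol hG, fun i l => contDiff_const,
    fun x ξ hξ => ?_, hasSUCPlin_pairSymbol hS hG hG0,
    fun x => appendCLE N (shearedSolution S 0 x, shearedSolution S G x),
    (appendCLE N).contDiff.comp
      ((contDiff_shearedSolution hz).prodMk (contDiff_shearedSolution hG)),
    fun x => ?_, ⟨EuclideanSpace.single 0 1, fun h => ?_⟩, ?_⟩
  · simp only [pairSymbol]
    rw [sum_smul_blockSum]
    exact isUnit_blockSum
      (isUnit_sum_shearedSymbol hS (fderiv_single_eq_zero hz (fun _ _ => rfl) x) hξ)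
      (isUnit_sum_shearedSymbol hS (fderiv_single_eq_zero hG hG0 x) hξ)
  · refine (linApply_blockSum (shearedSymbol S 0) (shearedSymbol S G)
      ((contDiff_shearedSolution hz).differentiable (by simp) x)
      ((contDiff_shearedSolution hG).differentiable (by simp) x)).trans ?_
    rw [sum_shearedSymbol_mulVec_shearedSolution hS hz (fun _ _ => rfl),
      sum_shearedSymbol_mulVec_shearedSolution hS hG hG0]
    exact map_zero _
  · simpa using ((hφ _).1 h).1
  · simp only [hφ, dimH_setOf_eq_zero, hdim]
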